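/- Fix ε ∈ [0,1]. Let N_ε ⊗ N_ε denote the tensor product of two qubit erasure channels, the channel taking a 4×4 density matrix ρ on ℂ²⊗ℂ² to the 9×9 matrix (N_ε ⊗ N_ε)(ρ) = ∑_{i,j} (A_i ⊗ A_j) ρ (A_i ⊗ A_j)†, where A_0 = √(1−ε)(|0⟩⟨0| + |1⟩⟨1|), A_1 = √ε |e⟩⟨0|, A_2 = √ε |e⟩⟨1| are the 3×2 Kraus operators of N_ε (|e⟩ being the third basis vector of ℂ³). Then the Holevo information is additive for two erasure channels: χ(N_ε ⊗ N_ε) = χ(N_ε) + χ(N_ε) = 2(1 − ε), where the supremum defining χ(N_ε ⊗ N_ε) runs over all finite ensembles of 4×4 density matrices, including entangled inputs. -/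

import Mathlib

open Matrix
open scoped BigOperators ComplexOrder Kronecker

/-- Von Neumann entropy in bits: `H(ρ) = -∑ λᵢ log₂ λᵢ` over the eigenvalues of a
Hermitian matrix (and `0` by convention on non-Hermitian input). -/
noncomputable def vNEntropy {d : Type} [Fintype d] [DecidableEq d]
    (ρ : Matrix d d ℂ) : ℝ :=
  if h : ρ.IsHermitian then (∑ i, Real.negMulLog (h.eigenvalues i)) / Real.log 2
  else 0

/-- `ρ` is a density matrix. -/
def IsDensityMatrix {d : Type} [Fintype d] [DecidableEq d]
    (ρ : Matrix d d ℂ) : Prop :=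
  ρ.PosSemidef ∧ ρ.trace = 1

/-- The qubit erasure channel with erasure parameter `ε`: the output is the
`3 × 3` matrix with upper-left `2 × 2` block `(1-ε)ρ`, entry `ε` at position
`(3,3)`, and zeros elsewhere. -/
noncomputable def erasureChannel (ε : ℝ) (ρ : Matrix (Fin 2) (Fin 2) ℂ) :
    Matrix (Fin 3) (Fin 3) ℂ :=
  fun i j =>
    if hi : (i : ℕ) < 2 then
      if hj : (j : ℕ) < 2 then ((1 - ε : ℝ) : ℂ) * ρ ⟨i, hi⟩ ⟨j, hj⟩ else 0
    else if (j : ℕ) < 2 then 0 else ((ε : ℝ) : ℂ)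

/-- The Kraus operators of the qubit erasure channel:
`A₀ = √(1-ε)(|0⟩⟨0| + |1⟩⟨1|)`, `A₁ = √ε |e⟩⟨0|`, `A₂ = √ε |e⟩⟨1|`, where `|e⟩`
is the third standard basis vector of `ℂ³`. -/
noncomputable def erasureKraus (ε : ℝ) : Fin 3 → Matrix (Fin 3) (Fin 2) ℂ :=
  ![fun i j => if (i : ℕ) = (j : ℕ) then ((Real.sqrt (1 - ε) : ℝ) : ℂ) else 0,
    fun i j => if (i : ℕ) = 2 ∧ (j : ℕ) = 0 then ((Real.sqrt ε : ℝ) : ℂ) else 0,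
    fun i j => if (i : ℕ) = 2 ∧ (j : ℕ) = 1 then ((Real.sqrt ε : ℝ) : ℂ) else 0]

/-- The tensor product `N_ε ⊗ N_ε` of two qubit erasure channels, acting on
`4 × 4` density matrices via the Kraus operators `Aᵢ ⊗ Aⱼ`. -/
noncomputable def erasureChannelTwo (ε : ℝ)
    (ρ : Matrix (Fin 2 × Fin 2) (Fin 2 × Fin 2) ℂ) :
    Matrix (Fin 3 × Fin 3) (Fin 3 × Fin 3) ℂ :=
  ∑ i : Fin 3, ∑ j : Fin 3,
    (erasureKraus ε i ⊗ₖ erasureKraus ε j) * ρ *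
      (erasureKraus ε i ⊗ₖ erasureKraus ε j)ᴴ

/-- The set of Holevo quantities of the single qubit erasure channel `N_ε`,
over all finite ensembles of qubit density matrices. -/
noncomputable def erasureHolevoSet (ε : ℝ) : Set ℝ :=
  { h | ∃ (k : ℕ) (p : Fin k → ℝ) (ρ : Fin k → Matrix (Fin 2) (Fin 2) ℂ),
      (∀ x, 0 ≤ p x) ∧ (∑ x, p x = 1) ∧ (∀ x, IsDensityMatrix (ρ x)) ∧
      h = vNEntropy (erasureChannel ε (∑ x, (p x : ℂ) • ρ x))
        - ∑ x, p x * vNEntropy (erasureChannel ε (ρ x)) }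

/-- The set of Holevo quantities of the tensor product channel `N_ε ⊗ N_ε`,
over all finite ensembles of `4 × 4` density matrices (including entangled
input states). -/
noncomputable def erasureHolevoSetTwo (ε : ℝ) : Set ℝ :=
  { h | ∃ (k : ℕ) (p : Fin k → ℝ)
      (ρ : Fin k → Matrix (Fin 2 × Fin 2) (Fin 2 × Fin 2) ℂ),
      (∀ x, 0 ≤ p x) ∧ (∑ x, p x = 1) ∧ (∀ x, IsDensityMatrix (ρ x)) ∧
      h = vNEntropy (erasureChannelTwo ε (∑ x, (p x : ℂ) • ρ x))
        - ∑ x, p x * vNEntropy (erasureChannelTwo ε (ρ x)) }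

/-- The entropy in bits of the real parts of the roots of the characteristic polynomial; this is
`vNEntropy` without its case distinction. -/
noncomputable def spectralEntropy {d : Type} [Fintype d] [DecidableEq d]
    (M : Matrix d d ℂ) : ℝ :=
  (M.charpoly.roots.map fun z => Real.negMulLog z.re).sum / Real.log 2

section SpectralEntropy

variable {m n : Type} [Fintype m] [DecidableEq m] [Fintype n] [DecidableEq n]

lemma vNEntropy_eq_spectralEntropy {M : Matrix n n ℂ} (hM : M.IsHermitian) :
    vNEntropy M = spectralEntropy M := by
  simp [vNEntropy, spectralEntropy, hM, hM.roots_charpoly_eq_eigenvalues]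

lemma spectralEntropy_of_charpoly_eq {M : Matrix n n ℂ} {v : n → ℝ}
    (h : M.charpoly = ∏ i, (Polynomial.X - Polynomial.C (v i : ℂ))) :
    spectralEntropy M = (∑ i, Real.negMulLog (v i)) / Real.log 2 := by
  have hr : M.charpoly.roots = Finset.univ.val.map fun i => (v i : ℂ) := by
    rw [h, Polynomial.roots_prod]
    · simp
    · simp [Finset.prod_ne_zero_iff, Polynomial.X_sub_C_ne_zero]
  simp [spectralEntropy, hr]

lemma spectralEntropy_diagonal (v : n → ℝ) :
    spectralEntropy (diagonal fun i => (v i : ℂ)) =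
      (∑ i, Real.negMulLog (v i)) / Real.log 2 :=
  spectralEntropy_of_charpoly_eq (charpoly_diagonal _)

lemma spectralEntropy_submatrix (e : m ≃ n) (M : Matrix n n ℂ) :
    spectralEntropy (M.submatrix e e) = spectralEntropy M := by
  have h : (M.submatrix e e).charpoly = M.charpoly := charpoly_reindex e.symm M
  rw [spectralEntropy, h, spectralEntropy]

lemma spectralEntropy_fromBlocks (A : Matrix m m ℂ) (B : Matrix n n ℂ) :
    spectralEntropy (fromBlocks A 0 0 B) = spectralEntropy A + spectralEntropy B := by
  have h := mul_ne_zero A.charpoly_monic.ne_zero B.charpoly_monic.ne_zero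
  rw [spectralEntropy, charpoly_fromBlocks_zero₁₂, Polynomial.roots_mul h, Multiset.map_add,
    Multiset.sum_add, add_div, spectralEntropy, spectralEntropy]

lemma IsDensityMatrix.sum_eigenvalues_eq_one {ρ : Matrix n n ℂ} (hρ : IsDensityMatrix ρ) :
    ∑ i, hρ.1.isHermitian.eigenvalues i = 1 := by
  have := hρ.1.isHermitian.trace_eq_sum_eigenvalues.symm.trans hρ.2
  simpa using congrArg Complex.re this

lemma spectralEntropy_smul (c : ℝ) {ρ : Matrix n n ℂ} (hρ : IsDensityMatrix ρ) :
    spectralEntropy ((c : ℂ) • ρ) =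
      Real.negMulLog c / Real.log 2 + c * spectralEntropy ρ := by
  have hH := hρ.1.isHermitian
  have hsum := hρ.sum_eigenvalues_eq_one
  have hc : ((c : ℂ) • ρ).charpoly =
      ∏ i, (Polynomial.X - Polynomial.C ((c * hH.eigenvalues i : ℝ) : ℂ)) := by
    conv_lhs => rw [hH.spectral_theorem, Unitary.conjStarAlgAut_apply, ← smul_mul_assoc,
      charpoly_mul_comm, mul_smul_comm, ← mul_assoc]
    simp [← diagonal_smul, charpoly_diagonal]
  rw [spectralEntropy_of_charpoly_eq hc, spectralEntropy_of_charpoly_eq (v := hH.eigenvalues) hH.charpoly_eq]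
  simp only [Real.negMulLog_mul, Finset.sum_add_distrib, ← Finset.sum_mul, ← Finset.mul_sum, hsum]
  ring

lemma IsDensityMatrix.sum_smul {k : ℕ} {p : Fin k → ℝ} {ρ : Fin k → Matrix n n ℂ}
    (hp : ∀ x, 0 ≤ p x) (hp1 : ∑ x, p x = 1) (hρ : ∀ x, IsDensityMatrix (ρ x)) :
    IsDensityMatrix (∑ x, (p x : ℂ) • ρ x) := by
  refine ⟨posSemidef_sum _ fun x _ => (hρ x).1.smul (by exact_mod_cast hp x), ?_⟩
  simp only [trace_sum, trace_smul, (hρ _).2, smul_eq_mul, mul_one]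
  exact_mod_cast hp1

lemma isDensityMatrix_diagonal_single (i : n) :
    IsDensityMatrix (diagonal fun j => ((Pi.single i 1 : n → ℝ) j : ℂ)) := by
  refine ⟨posSemidef_diagonal_iff.mpr fun j => ?_, ?_⟩
  · by_cases h : j = i <;> simp [h]
  · simp [trace_diagonal, Pi.single_apply, apply_ite Complex.ofReal]

lemma spectralEntropy_diagonal_single (i : n) :
    spectralEntropy (diagonal fun j => ((Pi.single i 1 : n → ℝ) j : ℂ)) = 0 := by
  rw [spectralEntropy_diagonal]
  simp [Pi.single_apply, apply_ite Real.negMulLog]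

lemma spectralEntropy_diagonal_uniform [Nonempty n] :
    spectralEntropy (diagonal fun _ : n => (((Fintype.card n : ℝ)⁻¹ : ℝ) : ℂ)) =
      Real.log (Fintype.card n) / Real.log 2 := by
  rw [spectralEntropy_diagonal fun _ => (Fintype.card n : ℝ)⁻¹]
  simp [Real.negMulLog, Real.log_inv]

lemma spectralEntropy_nonneg {ρ : Matrix n n ℂ} (hρ : IsDensityMatrix ρ) :
    0 ≤ spectralEntropy ρ := by
  have hH := hρ.1.isHermitian
  have hsum := hρ.sum_eigenvalues_eq_one
  have h0 := hρ.1.eigenvalues_nonneg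
  rw [spectralEntropy_of_charpoly_eq (v := hH.eigenvalues) hH.charpoly_eq]
  refine div_nonneg (Finset.sum_nonneg fun i _ => Real.negMulLog_nonneg (h0 i) ?_)
    (Real.log_nonneg one_le_two)
  rw [← hsum]
  exact Finset.single_le_sum (fun j _ => h0 j) (Finset.mem_univ i)

lemma spectralEntropy_le {ρ : Matrix n n ℂ} (hρ : IsDensityMatrix ρ) :
    spectralEntropy ρ ≤ Real.log (Fintype.card n) / Real.log 2 := by
  have hH := hρ.1.isHermitian
  have hsum := hρ.sum_eigenvalues_eq_one
  have hne : Nonempty n := by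
    by_contra h
    rw [not_nonempty_iff] at h
    simp at hsum
  have hcard : (0 : ℝ) < Fintype.card n := by exact_mod_cast Fintype.card_pos
  rw [spectralEntropy_of_charpoly_eq (v := hH.eigenvalues) hH.charpoly_eq]
  gcongr
  have hJ := Real.concaveOn_negMulLog.le_map_sum (t := Finset.univ)
    (w := fun _ : n => (Fintype.card n : ℝ)⁻¹) (p := hH.eigenvalues)
    (fun _ _ => by positivity) (by simp) (fun i _ => hρ.1.eigenvalues_nonneg i)
  simp only [smul_eq_mul, ← Finset.mul_sum, hsum, mul_one] at hJ
  rw [Real.negMulLog, Real.log_inv, neg_mul_neg] at hJ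
  exact le_of_mul_le_mul_left hJ (by positivity)

end SpectralEntropy

section PartialTrace

variable {m n : Type}

/-- The partial trace over the second tensor factor. -/
def traceRight [Fintype n] (ρ : Matrix (m × n) (m × n) ℂ) : Matrix m m ℂ :=
  ∑ b, ρ.submatrix (·, b) (·, b)

/-- The partial trace over the first tensor factor. -/
def traceLeft [Fintype m] (ρ : Matrix (m × n) (m × n) ℂ) : Matrix n n ℂ :=
  ∑ a, ρ.submatrix (a, ·) (a, ·)

lemma IsDensityMatrix.traceRight [Fintype m] [DecidableEq m] [Fintype n] [DecidableEq n]
    {ρ : Matrix (m × n) (m × n) ℂ} (hρ : IsDensityMatrix ρ) :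
    IsDensityMatrix (traceRight ρ) := by
  refine ⟨posSemidef_sum _ fun b _ => hρ.1.submatrix _, ?_⟩
  rw [← hρ.2]
  simp only [_root_.traceRight, trace, diag_apply, Matrix.sum_apply, submatrix_apply]
  rw [Fintype.sum_prod_type]

lemma IsDensityMatrix.traceLeft [Fintype m] [DecidableEq m] [Fintype n] [DecidableEq n]
    {ρ : Matrix (m × n) (m × n) ℂ} (hρ : IsDensityMatrix ρ) :
    IsDensityMatrix (traceLeft ρ) := by
  refine ⟨posSemidef_sum _ fun a _ => hρ.1.submatrix _, ?_⟩
  rw [← hρ.2]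
  simp only [_root_.traceLeft, trace, diag_apply, Matrix.sum_apply, submatrix_apply]
  rw [Fintype.sum_prod_type_right]

lemma traceRight_diagonal [DecidableEq m] [Fintype n] [DecidableEq n] (v : m × n → ℂ) :
    traceRight (diagonal v) = diagonal fun a => ∑ b, v (a, b) := by
  ext i j
  by_cases h : i = j <;> simp [traceRight, Matrix.sum_apply, h]

lemma traceLeft_diagonal [Fintype m] [DecidableEq m] [DecidableEq n] (v : m × n → ℂ) :
    traceLeft (diagonal v) = diagonal fun b => ∑ a, v (a, b) := by
  ext i j
  by_cases h : i = j <;> simp [traceLeft, Matrix.sum_apply, h]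

end PartialTrace

lemma isDensityMatrix_one_fin_one : IsDensityMatrix (1 : Matrix (Fin 1) (Fin 1) ℂ) :=
  ⟨.one, by simp⟩

lemma spectralEntropy_one_fin_one : spectralEntropy (1 : Matrix (Fin 1) (Fin 1) ℂ) = 0 := by
  simpa using spectralEntropy_diagonal (fun _ : Fin 1 => 1)

/-- The decomposition of the output space of `N_ε` into the input space and the erasure flag. -/
noncomputable def erasureFlagEquiv : Fin 2 ⊕ Fin 1 ≃ Fin 3 :=
  Equiv.ofBijective (Sum.elim Fin.castSucc fun _ => 2) (by decide)

lemma erasureChannel_submatrix (ε : ℝ) (ρ : Matrix (Fin 2) (Fin 2) ℂ) :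
    (erasureChannel ε ρ).submatrix erasureFlagEquiv erasureFlagEquiv =
      fromBlocks (((1 - ε : ℝ) : ℂ) • ρ) 0 0 ((ε : ℂ) • (1 : Matrix (Fin 1) (Fin 1) ℂ)) := by
  ext (i | i) (j | j) <;> fin_cases i <;> fin_cases j <;> simp [erasureChannel, erasureFlagEquiv]

lemma vNEntropy_erasureChannel (ε : ℝ) {ρ : Matrix (Fin 2) (Fin 2) ℂ} (hρ : IsDensityMatrix ρ) :
    vNEntropy (erasureChannel ε ρ) =
      (Real.negMulLog (1 - ε) + Real.negMulLog ε) / Real.log 2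
        + (1 - ε) * spectralEntropy ρ := by
  have hH : (erasureChannel ε ρ).IsHermitian := by
    rw [← isHermitian_submatrix_equiv erasureFlagEquiv, erasureChannel_submatrix]
    refine IsHermitian.fromBlocks ?_ (by simp) ?_
    · exact hρ.1.isHermitian.smul (by simp [IsSelfAdjoint])
    · exact isHermitian_one.smul (by simp [IsSelfAdjoint])
  rw [vNEntropy_eq_spectralEntropy hH, ← spectralEntropy_submatrix erasureFlagEquiv,
    erasureChannel_submatrix, spectralEntropy_fromBlocks, spectralEntropy_smul _ hρ,
    spectralEntropy_smul _ isDensityMatrix_one_fin_one, spectralEntropy_one_fin_one]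
  ring

/-- The decomposition of the output space of `N_ε ⊗ N_ε` according to which inputs are erased. -/
noncomputable def erasurePatternEquiv :
    (Fin 2 × Fin 2) ⊕ (Fin 2 ⊕ (Fin 2 ⊕ Fin 1)) ≃ Fin 3 × Fin 3 :=
  Equiv.ofBijective
    (Sum.elim (fun x => (x.1.castSucc, x.2.castSucc))
      (Sum.elim (fun a => (a.castSucc, 2)) (Sum.elim (fun b => (2, b.castSucc)) fun _ => (2, 2))))
    (by decide)

/-- The matrix elements of the superoperator of `N_ε`. -/
noncomputable def erasureCoeff (ε : ℝ) (i j : Fin 3) (x y : Fin 2) : ℂ :=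
  ∑ a, erasureKraus ε a i x * star (erasureKraus ε a j y)

lemma erasureChannelTwo_apply (ε : ℝ) (ρ : Matrix (Fin 2 × Fin 2) (Fin 2 × Fin 2) ℂ)
    (i j : Fin 3 × Fin 3) :
    erasureChannelTwo ε ρ i j =
      ∑ x, ∑ y, erasureCoeff ε i.1 j.1 x.1 y.1 * erasureCoeff ε i.2 j.2 x.2 y.2 * ρ x y := by
  have h (A B : Matrix (Fin 3) (Fin 2) ℂ) : ((A ⊗ₖ B) * ρ * (A ⊗ₖ B)ᴴ) i j =
      ∑ x, ∑ y, A i.1 x.1 * star (A j.1 y.1) * (B i.2 x.2 * star (B j.2 y.2)) * ρ x y := by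
    rw [mul_apply, Finset.sum_comm]
    refine Finset.sum_congr rfl fun y _ => ?_
    rw [mul_apply, Finset.sum_mul]
    refine Finset.sum_congr rfl fun x _ => ?_
    simp only [conjTranspose_apply, kroneckerMap_apply, star_mul']
    ring
  simp only [erasureChannelTwo, Matrix.sum_apply, h]
  simp only [erasureCoeff, Fin.sum_univ_three, ← Finset.sum_add_distrib]
  refine Finset.sum_congr rfl fun x _ => Finset.sum_congr rfl fun y _ => ?_
  ring

lemma erasureKraus_zero_castSucc (ε : ℝ) (i x : Fin 2) :
    erasureKraus ε 0 i.castSucc x = if i = x then ((Real.sqrt (1 - ε) : ℝ) : ℂ) else 0 :=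
  if_congr (Fin.val_inj (a := i)) rfl rfl

lemma erasureKraus_one_castSucc (ε : ℝ) (i x : Fin 2) : erasureKraus ε 1 i.castSucc x = 0 :=
  if_neg fun h => i.isLt.ne h.1

lemma erasureKraus_two_castSucc (ε : ℝ) (i x : Fin 2) : erasureKraus ε 2 i.castSucc x = 0 :=
  if_neg fun h => i.isLt.ne h.1

lemma erasureKraus_zero_two (ε : ℝ) (x : Fin 2) : erasureKraus ε 0 2 x = 0 :=
  if_neg x.isLt.ne'

lemma erasureKraus_one_two (ε : ℝ) (x : Fin 2) :
    erasureKraus ε 1 2 x = if x = 0 then ((Real.sqrt ε : ℝ) : ℂ) else 0 :=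
  if_congr ((and_iff_right rfl).trans (Fin.val_inj (b := 0))) rfl rfl

lemma erasureKraus_two_two (ε : ℝ) (x : Fin 2) :
    erasureKraus ε 2 2 x = if x = 1 then ((Real.sqrt ε : ℝ) : ℂ) else 0 :=
  if_congr ((and_iff_right rfl).trans (Fin.val_inj (b := 1))) rfl rfl

lemma erasureCoeff_castSucc_castSucc {ε : ℝ} (hε : ε ≤ 1) (i j x y : Fin 2) :
    erasureCoeff ε i.castSucc j.castSucc x y =
      if i = x ∧ j = y then ((1 - ε : ℝ) : ℂ) else 0 := by
  have hs : ((Real.sqrt (1 - ε) : ℝ) : ℂ) * (Real.sqrt (1 - ε) : ℝ) = ((1 - ε : ℝ) : ℂ) := by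
    exact_mod_cast Real.mul_self_sqrt (sub_nonneg.mpr hε)
  rw [← hs, erasureCoeff, Fin.sum_univ_three]
  simp only [erasureKraus_zero_castSucc, erasureKraus_one_castSucc, erasureKraus_two_castSucc]
  by_cases hi : i = x <;> by_cases hj : j = y <;> simp [hi, hj]

lemma erasureCoeff_castSucc_two (ε : ℝ) (i x y : Fin 2) :
    erasureCoeff ε i.castSucc 2 x y = 0 := by
  simp [erasureCoeff, Fin.sum_univ_three, erasureKraus_one_castSucc, erasureKraus_two_castSucc,
    erasureKraus_zero_two]

lemma erasureCoeff_two_castSucc (ε : ℝ) (j x y : Fin 2) :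
    erasureCoeff ε 2 j.castSucc x y = 0 := by
  simp [erasureCoeff, Fin.sum_univ_three, erasureKraus_one_castSucc, erasureKraus_two_castSucc,
    erasureKraus_zero_two]

lemma erasureCoeff_two_two {ε : ℝ} (hε : 0 ≤ ε) (x y : Fin 2) :
    erasureCoeff ε 2 2 x y = if x = y then (ε : ℂ) else 0 := by
  have hs : ((Real.sqrt ε : ℝ) : ℂ) * (Real.sqrt ε : ℝ) = (ε : ℂ) := by
    exact_mod_cast Real.mul_self_sqrt hε
  rw [← hs, erasureCoeff, Fin.sum_univ_three]
  simp only [erasureKraus_zero_two, erasureKraus_one_two, erasureKraus_two_two]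
  fin_cases x <;> fin_cases y <;> simp

lemma erasureChannelTwo_submatrix {ε : ℝ} (hε : ε ∈ Set.Icc (0 : ℝ) 1)
    {ρ : Matrix (Fin 2 × Fin 2) (Fin 2 × Fin 2) ℂ} (hρ : IsDensityMatrix ρ) :
    (erasureChannelTwo ε ρ).submatrix erasurePatternEquiv erasurePatternEquiv =
      fromBlocks ((((1 - ε) * (1 - ε) : ℝ) : ℂ) • ρ) 0 0
        (fromBlocks ((((1 - ε) * ε : ℝ) : ℂ) • traceRight ρ) 0 0
          (fromBlocks (((ε * (1 - ε) : ℝ) : ℂ) • traceLeft ρ) 0 0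
            (((ε * ε : ℝ) : ℂ) • (1 : Matrix (Fin 1) (Fin 1) ℂ)))) := by
  have htr : ρ (0, 0) (0, 0) + ρ (0, 1) (0, 1) + ρ (1, 0) (1, 0) + ρ (1, 1) (1, 1) = 1 := by
    rw [← hρ.2]
    simp [trace, Fintype.sum_prod_type, add_assoc]
  ext (⟨i, i'⟩ | i | i | i) (⟨j, j'⟩ | j | j | j) <;>
    simp only [submatrix_apply, erasurePatternEquiv, Equiv.ofBijective_apply, Sum.elim_inl,
      Sum.elim_inr, erasureChannelTwo_apply, erasureCoeff_castSucc_castSucc hε.2,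
      erasureCoeff_castSucc_two, erasureCoeff_two_castSucc, erasureCoeff_two_two hε.1,
      zero_mul, mul_zero, Finset.sum_const_zero, fromBlocks_apply₁₁, fromBlocks_apply₁₂,
      fromBlocks_apply₂₁, fromBlocks_apply₂₂, Matrix.zero_apply, Matrix.smul_apply, smul_eq_mul]
  · simp [Fintype.sum_prod_type, ite_and, mul_assoc]
  · simp [Fintype.sum_prod_type, ite_and, traceRight, Matrix.sum_apply, mul_assoc, mul_add]
  · simp [Fintype.sum_prod_type, ite_and, traceLeft, Matrix.sum_apply, mul_assoc, mul_add]
  · rw [Subsingleton.elim i j]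
    simp [Fintype.sum_prod_type]
    linear_combination (ε : ℂ) * ε * htr

lemma vNEntropy_erasureChannelTwo {ε : ℝ} (hε : ε ∈ Set.Icc (0 : ℝ) 1)
    {ρ : Matrix (Fin 2 × Fin 2) (Fin 2 × Fin 2) ℂ} (hρ : IsDensityMatrix ρ) :
    vNEntropy (erasureChannelTwo ε ρ) =
      2 * (Real.negMulLog (1 - ε) + Real.negMulLog ε) / Real.log 2
        + ((1 - ε) * (1 - ε) * spectralEntropy ρ
          + (1 - ε) * ε * (spectralEntropy (traceRight ρ) + spectralEntropy (traceLeft ρ))) := by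
  have hH : (erasureChannelTwo ε ρ).IsHermitian :=
    (posSemidef_sum _ fun i _ => posSemidef_sum _ fun j _ =>
      hρ.1.mul_mul_conjTranspose_same _).isHermitian
  rw [vNEntropy_eq_spectralEntropy hH, ← spectralEntropy_submatrix erasurePatternEquiv,
    erasureChannelTwo_submatrix hε hρ]
  simp only [spectralEntropy_fromBlocks, spectralEntropy_smul _ hρ,
    spectralEntropy_smul _ hρ.traceRight, spectralEntropy_smul _ hρ.traceLeft,
    spectralEntropy_smul _ isDensityMatrix_one_fin_one, spectralEntropy_one_fin_one,
    Real.negMulLog_mul]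
  ring

lemma sum_mul_const_add {k : ℕ} {p : Fin k → ℝ} (hp1 : ∑ x, p x = 1) (c : ℝ) (f : Fin k → ℝ) :
    ∑ x, p x * (c + f x) = c + ∑ x, p x * f x := by
  simp [mul_add, Finset.sum_add_distrib, ← Finset.sum_mul, hp1]

lemma sum_smul_diagonal_single {n : Type} [Fintype n] [DecidableEq n] {k : ℕ} (e : Fin k ≃ n)
    (c : ℝ) :
    ∑ x, (c : ℂ) • (diagonal fun j => ((Pi.single (e x) 1 : n → ℝ) j : ℂ)) =
      diagonal fun _ => (c : ℂ) := by
  rw [e.sum_comp fun y => (c : ℂ) • (diagonal fun j => ((Pi.single y 1 : n → ℝ) j : ℂ))]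
  ext i j
  by_cases h : i = j <;> simp [Matrix.sum_apply, h, Pi.single_apply, apply_ite Complex.ofReal]

lemma log_four_div_log_two : Real.log 4 / Real.log 2 = 2 := by
  rw [show (4 : ℝ) = 2 ^ 2 by norm_num, Real.log_pow]
  have := (Real.log_pos one_lt_two).ne'
  push_cast
  field_simp

lemma isGreatest_erasureHolevoSet {ε : ℝ} (hε : ε ∈ Set.Icc (0 : ℝ) 1) :
    IsGreatest (erasureHolevoSet ε) (1 - ε) := by
  have h1ε : 0 ≤ 1 - ε := sub_nonneg.mpr hε.2
  have hlog := div_self (Real.log_pos one_lt_two).ne'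
  constructor
  · refine ⟨2, fun _ => 2⁻¹, fun x => diagonal fun j => ((Pi.single x 1 : Fin 2 → ℝ) j : ℂ),
      fun _ => by norm_num, by norm_num, isDensityMatrix_diagonal_single, ?_⟩
    have hmean := IsDensityMatrix.sum_smul (p := fun _ : Fin 2 => 2⁻¹) (fun _ => by norm_num)
      (by norm_num) (isDensityMatrix_diagonal_single (n := Fin 2))
    have hsum := sum_smul_diagonal_single (Equiv.refl (Fin 2)) 2⁻¹
    simp only [Equiv.refl_apply] at hsum
    rw [vNEntropy_erasureChannel _ hmean, hsum]
    simp only [vNEntropy_erasureChannel _ (isDensityMatrix_diagonal_single _),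
      spectralEntropy_diagonal_single]
    have hu := spectralEntropy_diagonal_uniform (n := Fin 2)
    simp only [Fintype.card_fin, Nat.cast_ofNat, hlog] at hu
    rw [hu, Fin.sum_univ_two]
    ring
  · rintro _ ⟨k, p, ρ, hp, hp1, hρ, rfl⟩
    have hmean := IsDensityMatrix.sum_smul hp hp1 hρ
    simp only [vNEntropy_erasureChannel _ hmean, vNEntropy_erasureChannel _ (hρ _),
      sum_mul_const_add hp1]
    have hle := spectralEntropy_le hmean
    simp only [Fintype.card_fin, Nat.cast_ofNat, hlog] at hle
    have hnn : 0 ≤ ∑ x, p x * ((1 - ε) * spectralEntropy (ρ x)) := Finset.sum_nonneg fun x _ =>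
      mul_nonneg (hp x) (mul_nonneg h1ε (spectralEntropy_nonneg (hρ x)))
    nlinarith

lemma isGreatest_erasureHolevoSetTwo {ε : ℝ} (hε : ε ∈ Set.Icc (0 : ℝ) 1) :
    IsGreatest (erasureHolevoSetTwo ε) (2 * (1 - ε)) := by
  have h1ε : 0 ≤ 1 - ε := sub_nonneg.mpr hε.2
  have hlog := div_self (Real.log_pos one_lt_two).ne'
  constructor
  · let e : Fin (2 * 2) ≃ Fin 2 × Fin 2 := finProdFinEquiv.symm
    refine ⟨2 * 2, fun _ => 4⁻¹,
      fun x => diagonal fun j => ((Pi.single (e x) 1 : Fin 2 × Fin 2 → ℝ) j : ℂ),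
      fun _ => by norm_num, by norm_num, fun x => isDensityMatrix_diagonal_single (e x), ?_⟩
    have hmean := IsDensityMatrix.sum_smul (p := fun _ : Fin (2 * 2) => 4⁻¹)
      (fun _ => by norm_num) (by norm_num) (fun x => isDensityMatrix_diagonal_single (e x))
    have hR (x) : traceRight (diagonal fun j => ((Pi.single x 1 : Fin 2 × Fin 2 → ℝ) j : ℂ)) =
        diagonal fun j => ((Pi.single x.1 1 : Fin 2 → ℝ) j : ℂ) := by
      rw [traceRight_diagonal]
      obtain ⟨a, b⟩ := x
      congr 1
      ext j
      by_cases h : j = a <;> fin_cases b <;> simp [Pi.single_apply, h]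
    have hL (x) : traceLeft (diagonal fun j => ((Pi.single x 1 : Fin 2 × Fin 2 → ℝ) j : ℂ)) =
        diagonal fun j => ((Pi.single x.2 1 : Fin 2 → ℝ) j : ℂ) := by
      rw [traceLeft_diagonal]
      obtain ⟨a, b⟩ := x
      congr 1
      ext j
      by_cases h : j = b <;> fin_cases a <;> simp [Pi.single_apply, h]
    have hhalf : ∑ _ : Fin 2, (((4 : ℝ)⁻¹ : ℝ) : ℂ) = (((2 : ℝ)⁻¹ : ℝ) : ℂ) := by
      norm_num
    rw [vNEntropy_erasureChannelTwo hε hmean, sum_smul_diagonal_single e, traceRight_diagonal,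
      traceLeft_diagonal]
    simp only [vNEntropy_erasureChannelTwo hε (isDensityMatrix_diagonal_single _), hR, hL, hhalf,
      spectralEntropy_diagonal_single]
    have hu := spectralEntropy_diagonal_uniform (n := Fin 2)
    have hu' := spectralEntropy_diagonal_uniform (n := Fin 2 × Fin 2)
    simp only [Fintype.card_prod, Fintype.card_fin, Nat.cast_ofNat, hlog, Nat.reduceMul,
      log_four_div_log_two] at hu hu'
    rw [hu, hu', ← Finset.sum_mul]
    norm_num
    ring
  · rintro _ ⟨k, p, ρ, hp, hp1, hρ, rfl⟩
    have hmean := IsDensityMatrix.sum_smul hp hp1 hρ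
    simp only [vNEntropy_erasureChannelTwo hε hmean, vNEntropy_erasureChannelTwo hε (hρ _),
      sum_mul_const_add hp1]
    have hle := spectralEntropy_le hmean
    have hleR := spectralEntropy_le hmean.traceRight
    have hleL := spectralEntropy_le hmean.traceLeft
    simp only [Fintype.card_prod, Fintype.card_fin, Nat.cast_ofNat, hlog, Nat.reduceMul,
      log_four_div_log_two] at hle hleR hleL
    have hsq := mul_nonneg h1ε h1ε
    have hmix := mul_nonneg h1ε hε.1
    have hnn : 0 ≤ ∑ x, p x * ((1 - ε) * (1 - ε) * spectralEntropy (ρ x) + (1 - ε) * ε *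
        (spectralEntropy (traceRight (ρ x)) + spectralEntropy (traceLeft (ρ x)))) :=
      Finset.sum_nonneg fun x _ => mul_nonneg (hp x) <| add_nonneg
        (mul_nonneg hsq (spectralEntropy_nonneg (hρ x)))
        (mul_nonneg hmix (add_nonneg (spectralEntropy_nonneg (hρ x).traceRight)
          (spectralEntropy_nonneg (hρ x).traceLeft)))
    linarith [mul_le_mul_of_nonneg_left hle hsq,
      mul_le_mul_of_nonneg_left (add_le_add hleR hleL) hmix]

/-- Additivity of the Holevo information for two qubit erasure channels:
`χ(N_ε ⊗ N_ε) = χ(N_ε) + χ(N_ε) = 2(1-ε)`, where each Holevo information is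
the (attained) greatest element of the corresponding set of Holevo quantities. -/
theorem erasure_holevo_additive (ε : ℝ) (hε : ε ∈ Set.Icc (0 : ℝ) 1) :
    IsGreatest (erasureHolevoSetTwo ε) (2 * (1 - ε)) ∧
    IsGreatest (erasureHolevoSet ε) (1 - ε) ∧
    2 * (1 - ε) = (1 - ε) + (1 - ε) :=
  ⟨isGreatest_erasureHolevoSetTwo hε, isGreatest_erasureHolevoSet hε, two_mul _⟩
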